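/- For every λ > 0, the measure μ_{1,λ} is a probability measure; explicitly, max(0, 1 − 1/λ²) + ∫_{λ−2}^{λ+2} √(4 − (x − λ)²)/(2π(λx + 1)) dx = 1. In particular, for 0 < λ ≤ 1 the density √(4 − (x − λ)²)/(2π(λx + 1)) on [λ − 2, λ + 2] integrates to 1, while for λ > 1 it integrates to 1/λ². -/

import Mathlib

open MeasureTheory

-- Absolutely continuous part of `μ_{1,λ}`: density
-- `x ↦ √(4 − (x − λ)²)/(2π(λx + 1))` on `[λ − 2, λ + 2]`, `0` elsewhere.
open Classical in
noncomputable def muOneAC (lam : ℝ) : Measure ℝ :=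
  volume.withDensity fun x =>
    ENNReal.ofReal (if x ∈ Set.Icc (lam - 2) (lam + 2) then
      Real.sqrt (4 - (x - lam) ^ 2) / (2 * Real.pi * (lam * x + 1)) else 0)

-- `μ_{1,λ} = max(0, 1 − 1/λ²)·δ_{−1/λ} + μ^{ac}_{1,λ}`.
noncomputable def muOne (lam : ℝ) : Measure ℝ :=
  (ENNReal.ofReal (max 0 (1 - 1 / lam ^ 2))) • Measure.dirac (-(1 / lam)) + muOneAC lam

/-- On the support of the absolutely continuous part, `lam * x + 1` is at least
`(lam - 1) ^ 2`. -/
theorem sq_sub_one_le_of_mem_Icc {lam x : ℝ} (hlam : 0 < lam)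
    (hx : x ∈ Set.Icc (lam - 2) (lam + 2)) : (lam - 1) ^ 2 ≤ lam * x + 1 := by
  nlinarith [mul_le_mul_of_nonneg_left hx.1 hlam.le]

theorem muOne_density_nonneg {lam x : ℝ} (hlam : 0 < lam)
    (hx : x ∈ Set.Icc (lam - 2) (lam + 2)) :
    0 ≤ Real.sqrt (4 - (x - lam) ^ 2) / (2 * Real.pi * (lam * x + 1)) := by
  have h : 0 ≤ lam * x + 1 := (sq_nonneg _).trans (sq_sub_one_le_of_mem_Icc hlam hx)
  positivity

/-- The fractional linear map fixing the endpoints of the support, rescaled to `[-1, 1]`. -/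
noncomputable def muOneMobius (lam x : ℝ) : ℝ :=
  (2 * lam + (lam ^ 2 + 1) * ((x - lam) / 2)) / (lam * x + 1)

/-- An antiderivative of `2π` times the density of `muOneAC`. -/
noncomputable def muOnePrimitive (lam x : ℝ) : ℝ :=
  Real.sqrt (4 - (x - lam) ^ 2) / lam
    + (lam ^ 2 + 1) / lam ^ 2 * Real.arcsin ((x - lam) / 2)
    - |lam ^ 2 - 1| * Real.arcsin (muOneMobius lam x) / lam ^ 2

theorem muOnePrimitive_continuousOn {lam : ℝ} (hlam : 0 < lam) :
    ContinuousOn (muOnePrimitive lam) (Set.Icc (lam - 2) (lam + 2)) := by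
  unfold muOnePrimitive
  refine ContinuousOn.sub (by fun_prop) (ContinuousOn.div_const ?_ _)
  rcases eq_or_ne lam 1 with rfl | h1
  · simpa using continuousOn_const
  · refine continuousOn_const.mul (Real.continuous_arcsin.comp_continuousOn ?_)
    unfold muOneMobius
    refine ContinuousOn.div (by fun_prop) (by fun_prop) fun x hx => ?_
    have := sq_sub_one_le_of_mem_Icc hlam hx
    have := sq_pos_of_ne_zero (sub_ne_zero.2 h1)
    linarith

theorem hasDerivAt_abs_mul_arcsin_muOneMobius {lam x : ℝ} (hD : 0 < lam * x + 1)
    (hs : 0 < 4 - (x - lam) ^ 2) :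
    HasDerivAt (fun x => |lam ^ 2 - 1| * Real.arcsin (muOneMobius lam x))
      ((lam ^ 2 - 1) ^ 2 / ((lam * x + 1) * Real.sqrt (4 - (x - lam) ^ 2))) x := by
  rcases eq_or_ne (lam ^ 2 - 1) 0 with h1 | h1
  · simpa [h1] using hasDerivAt_const x (0 : ℝ)
  have habs : 0 < |lam ^ 2 - 1| := abs_pos.2 h1
  have hsq : 1 - muOneMobius lam x ^ 2
      = (|lam ^ 2 - 1| * Real.sqrt (4 - (x - lam) ^ 2) / (2 * (lam * x + 1))) ^ 2 := by
    rw [div_pow, mul_pow, Real.sq_sqrt hs.le, sq_abs, muOneMobius]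
    field_simp
    ring
  have hpos : 0 < 1 - muOneMobius lam x ^ 2 := by
    have := Real.sqrt_pos.2 hs
    rw [hsq]
    positivity
  have hmob : HasDerivAt (muOneMobius lam) ((lam ^ 2 - 1) ^ 2 / (2 * (lam * x + 1) ^ 2)) x := by
    have hnum : HasDerivAt (fun x : ℝ => 2 * lam + (lam ^ 2 + 1) * ((x - lam) / 2))
        ((lam ^ 2 + 1) * (1 / 2)) x :=
      ((((hasDerivAt_id x).sub_const lam).div_const 2).const_mul _).const_add _
    have hden : HasDerivAt (fun x : ℝ => lam * x + 1) (lam * 1) x :=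
      ((hasDerivAt_id x).const_mul lam).add_const 1
    refine (hnum.div hden hD.ne').congr_deriv ?_
    have := hD.ne'
    field_simp
    ring
  have harc := (Real.hasDerivAt_arcsin (x := muOneMobius lam x) (by rintro h; simp [h] at hpos)
    (by rintro h; simp [h] at hpos)).comp x hmob
  refine (harc.const_mul |lam ^ 2 - 1|).congr_deriv ?_
  have := Real.sqrt_pos.2 hs
  rw [hsq, Real.sqrt_sq (by positivity)]
  field_simp

theorem hasDerivAt_muOnePrimitive {lam x : ℝ} (hlam : 0 < lam)
    (hx : x ∈ Set.Ioo (lam - 2) (lam + 2)) :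
    HasDerivAt (muOnePrimitive lam) (Real.sqrt (4 - (x - lam) ^ 2) / (lam * x + 1)) x := by
  have hD : 0 < lam * x + 1 := by
    nlinarith [mul_lt_mul_of_pos_left hx.1 hlam, sq_nonneg (lam - 1)]
  have hs : 0 < 4 - (x - lam) ^ 2 := by nlinarith [hx.1, hx.2]
  have hr := Real.sqrt_pos.2 hs
  have hsub : HasDerivAt (fun x : ℝ => x - lam) 1 x := (hasDerivAt_id x).sub_const lam
  have hsqrt := ((hsub.pow 2).const_sub 4).sqrt hs.ne'
  have harc := (Real.hasDerivAt_arcsin (x := (x - lam) / 2) (by linarith [hx.1])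
    (by linarith [hx.2])).comp x (hsub.div_const 2)
  have hroot : Real.sqrt (1 - ((x - lam) / 2) ^ 2) = Real.sqrt (4 - (x - lam) ^ 2) / 2 := by
    rw [Real.sqrt_eq_iff_mul_self_eq_of_pos (by positivity)]
    nlinarith [Real.mul_self_sqrt hs.le]
  refine (((hsqrt.div_const lam).add (harc.const_mul ((lam ^ 2 + 1) / lam ^ 2))).sub
    ((hasDerivAt_abs_mul_arcsin_muOneMobius hD hs).div_const (lam ^ 2))).congr_deriv ?_
  rw [hroot]
  have h2 := Real.sq_sqrt hs.le
  simp only [Pi.pow_apply]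
  generalize Real.sqrt (4 - (x - lam) ^ 2) = r at h2 hr ⊢
  generalize hd : lam * x + 1 = d at hD ⊢
  have hx' : x = (d - 1) / lam := by rw [eq_div_iff hlam.ne']; linarith
  push_cast
  field_simp
  rw [h2, hx']
  field_simp
  ring

theorem hasDerivAt_muOnePrimitive_div {lam x : ℝ} (hlam : 0 < lam)
    (hx : x ∈ Set.Ioo (lam - 2) (lam + 2)) :
    HasDerivAt (fun x => muOnePrimitive lam x / (2 * Real.pi))
      (Real.sqrt (4 - (x - lam) ^ 2) / (2 * Real.pi * (lam * x + 1))) x := by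
  refine ((hasDerivAt_muOnePrimitive hlam hx).div_const _).congr_deriv ?_
  rw [div_div, mul_comm (lam * x + 1)]

theorem muOne_density_intervalIntegrable {lam : ℝ} (hlam : 0 < lam) :
    IntervalIntegrable (fun x => Real.sqrt (4 - (x - lam) ^ 2) / (2 * Real.pi * (lam * x + 1)))
      volume (lam - 2) (lam + 2) := by
  have hle : lam - 2 ≤ lam + 2 := by linarith
  refine intervalIntegral.intervalIntegrable_deriv_of_nonneg
    (g := fun x => muOnePrimitive lam x / (2 * Real.pi)) ?_ ?_ ?_
  · rw [Set.uIcc_of_le hle]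
    exact (muOnePrimitive_continuousOn hlam).div_const _
  · rw [min_eq_left hle, max_eq_right hle]
    exact fun x hx => hasDerivAt_muOnePrimitive_div hlam hx
  · rw [min_eq_left hle, max_eq_right hle]
    exact fun x hx => muOne_density_nonneg hlam (Set.Ioo_subset_Icc_self hx)

theorem abs_mul_arcsin_muOneMobius_right {lam : ℝ} (hlam : 0 < lam) :
    |lam ^ 2 - 1| * Real.arcsin (muOneMobius lam (lam + 2)) = |lam ^ 2 - 1| * (Real.pi / 2) := by
  have : muOneMobius lam (lam + 2) = 1 := by
    rw [muOneMobius, div_eq_one_iff_eq (by positivity)]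
    ring
  rw [this, Real.arcsin_one]

theorem abs_mul_arcsin_muOneMobius_left (lam : ℝ) :
    |lam ^ 2 - 1| * Real.arcsin (muOneMobius lam (lam - 2))
      = |lam ^ 2 - 1| * (-(Real.pi / 2)) := by
  rcases eq_or_ne lam 1 with rfl | h1
  · simp
  have hD : lam * (lam - 2) + 1 ≠ 0 := by
    have := pow_ne_zero 2 (sub_ne_zero.2 h1)
    intro h
    exact this (by linarith)
  have : muOneMobius lam (lam - 2) = -1 := by
    rw [muOneMobius, div_eq_iff hD]
    ring
  rw [this, Real.arcsin_neg_one]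

theorem muOne_density_integral {lam : ℝ} (hlam : 0 < lam) :
    max 0 (1 - 1 / lam ^ 2) +
      (∫ x in (lam - 2)..(lam + 2),
        Real.sqrt (4 - (x - lam) ^ 2) / (2 * Real.pi * (lam * x + 1))) = 1 := by
  rw [intervalIntegral.integral_eq_sub_of_hasDerivAt_of_le (by linarith)
    ((muOnePrimitive_continuousOn hlam).div_const (2 * Real.pi))
    (fun x hx => hasDerivAt_muOnePrimitive_div hlam hx) (muOne_density_intervalIntegrable hlam)]
  have hr : muOnePrimitive lam (lam + 2) =
      ((lam ^ 2 + 1) - |lam ^ 2 - 1|) / lam ^ 2 * (Real.pi / 2) := by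
    have e1 : 4 - (lam + 2 - lam) ^ 2 = 0 := by ring
    have e2 : (lam + 2 - lam) / 2 = 1 := by ring
    rw [muOnePrimitive, abs_mul_arcsin_muOneMobius_right hlam, e1, e2, Real.sqrt_zero,
      Real.arcsin_one]
    ring
  have hl : muOnePrimitive lam (lam - 2) =
      -(((lam ^ 2 + 1) - |lam ^ 2 - 1|) / lam ^ 2 * (Real.pi / 2)) := by
    have e1 : 4 - (lam - 2 - lam) ^ 2 = 0 := by ring
    have e2 : (lam - 2 - lam) / 2 = -1 := by ring
    rw [muOnePrimitive, abs_mul_arcsin_muOneMobius_left, e1, e2, Real.sqrt_zero,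
      Real.arcsin_neg_one]
    ring
  have hpi := Real.pi_pos
  rw [hr, hl]
  rcases le_total lam 1 with h | h
  · have h1 : lam ^ 2 ≤ 1 := pow_le_one₀ hlam.le h
    rw [max_eq_left (sub_nonpos.2 ((one_le_div (by positivity)).2 h1)),
      abs_of_nonpos (sub_nonpos.2 h1)]
    field_simp
    ring
  · have h1 : 1 ≤ lam ^ 2 := one_le_pow₀ h
    rw [max_eq_right (sub_nonneg.2 ((div_le_one (by positivity)).2 h1)),
      abs_of_nonneg (sub_nonneg.2 h1)]
    field_simp
    ring

theorem stmt2 (lam : ℝ) (hlam : 0 < lam) :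
    IsProbabilityMeasure (muOne lam) ∧
      max 0 (1 - 1 / lam ^ 2) +
        (∫ x in (lam - 2)..(lam + 2),
          Real.sqrt (4 - (x - lam) ^ 2) / (2 * Real.pi * (lam * x + 1))) = 1 := by
  have hint := muOne_density_intervalIntegrable hlam
  have hval := muOne_density_integral hlam
  have hle : lam - 2 ≤ lam + 2 := by linarith
  set I := ∫ x in (lam - 2)..(lam + 2),
    Real.sqrt (4 - (x - lam) ^ 2) / (2 * Real.pi * (lam * x + 1)) with hI
  have hI0 : 0 ≤ I :=
    intervalIntegral.integral_nonneg hle fun x hx => muOne_density_nonneg hlam hx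
  have hmass : muOneAC lam Set.univ = ENNReal.ofReal I := by
    rw [muOneAC, withDensity_apply _ MeasurableSet.univ, Measure.restrict_univ, hI,
      intervalIntegral.integral_of_le hle, ← integral_Icc_eq_integral_Ioc,
      ofReal_integral_eq_lintegral_ofReal
        ((intervalIntegrable_iff_integrableOn_Icc_of_le hle).1 hint)
        ((ae_restrict_iff' measurableSet_Icc).2
          (Filter.Eventually.of_forall fun x hx => muOne_density_nonneg hlam hx)),
      ← lintegral_indicator measurableSet_Icc]
    refine lintegral_congr fun x => ?_
    by_cases hx : x ∈ Set.Icc (lam - 2) (lam + 2) <;>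
      simp only [Set.indicator, hx, if_true, if_false, ENNReal.ofReal_zero]
  refine ⟨⟨?_⟩, hval⟩
  rw [muOne, Measure.add_apply, Measure.smul_apply, hmass, measure_univ, smul_eq_mul, mul_one,
    ← ENNReal.ofReal_add (le_max_left _ _) hI0, hval, ENNReal.ofReal_one]
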